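/- Let E be the extension operator of the surface {(ξ₁, ξ₂, ξ₃, ξ₁ξ₂ + ξ₃², ξ₁²) : ξ ∈ [0,1]³} ⊂ ℝ⁵. Then for every p > 4 there exist ε = ε(p) > 0, K = K(p) ≥ 1 and a constant C_p such that for every M with K ≤ M ≤ (R')^{1/2}, every R' with K² ≤ R', every interval I ⊂ [0,1] of length 1/M, every ball B_{R'} ⊂ ℝ⁵ of radius R', and every f, ‖E(f·1_{I×[0,1]²})‖_{L^p(B_{R'})} ≤ C_p M^{−ε} ‖f‖_{L^p([0,1]³)}. -/

import Mathlib

open MeasureTheory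

noncomputable section

/-- The unit cube `[0,1]³`. -/
def cube3 : Set (Fin 3 → ℝ) := Set.Icc (fun _ => 0) (fun _ => 1)

/-- The extension operator of the surface
`{(ξ₁, ξ₂, ξ₃, ξ₁ξ₂ + ξ₃², ξ₁²) : ξ ∈ [0,1]³} ⊂ ℝ⁵`. -/
def eD (f : (Fin 3 → ℝ) → ℂ) (x : EuclideanSpace ℝ (Fin 5)) : ℂ :=
  ∫ ξ in cube3, f ξ * Complex.exp (2 * (Real.pi : ℂ) * Complex.I *
    ((ξ 0 * x 0 + ξ 1 * x 1 + ξ 2 * x 2 + (ξ 0 * ξ 1 + ξ 2 ^ 2) * x 3 + ξ 0 ^ 2 * x 4 : ℝ) : ℂ))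

open scoped ENNReal FourierTransform SchwartzMap ContDiff InnerProductSpace

abbrev V5 := EuclideanSpace ℝ (Fin 5)

lemma plancherel_le (g : V5 → ℂ) (h1 : Integrable g) (h2 : MemLp g 2) :
    eLpNorm (𝓕 g) 2 volume ≤ eLpNorm g 2 volume := by
  set G : Lp ℂ 2 (volume : Measure V5) := h2.toLp g with hG
  have hcont : Continuous (𝓕 g) :=
    VectorFourier.fourierIntegral_continuous Real.continuous_fourierChar
      (by exact continuous_inner) h1
  have key : ∀ᵐ x : V5, (𝓕 G : Lp ℂ 2 (volume : Measure V5)) x = 𝓕 g x := by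
    apply ae_eq_of_integral_contDiff_smul_eq
    · exact (Lp.memLp (𝓕 G : Lp ℂ 2 (volume : Measure V5))).locallyIntegrable (by norm_num)
    · exact hcont.locallyIntegrable
    · intro ψ hψ hψc
      have hc : HasCompactSupport (fun x => (ψ x : ℂ)) :=
        hψc.comp_left (g := fun r : ℝ => (r : ℂ)) (by simp)
      set Ψ : 𝓢(V5, ℂ) := hc.toSchwartzMap (Complex.ofRealCLM.contDiff.comp hψ) with hΨ
      have e0 := congrArg (fun T => T Ψ) (Lp.fourier_toTemperedDistribution_eq G)
      simp only [TemperedDistribution.fourier_apply, Lp.toTemperedDistribution_apply] at e0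
      have e1 : ∀ x, Ψ x = (ψ x : ℂ) := fun x => rfl
      have e2 := VectorFourier.integral_fourierIntegral_smul_eq_flip (L := innerₗ V5) (μ := volume) (ν := volume)
        (f := (Ψ : V5 → ℂ)) (g := g) Real.continuous_fourierChar (by exact continuous_inner)
        Ψ.integrable h1
      have e3 : ∫ x, (𝓕 Ψ) x • G x = ∫ x, (𝓕 Ψ) x • g x := by
        apply integral_congr_ae
        filter_upwards [h2.coeFn_toLp] with x hx
        rw [hG, hx]
      rw [e3] at e0
      have e4 : ∫ x, (𝓕 Ψ) x • g x = ∫ x, Ψ x • 𝓕 g x := by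
        rw [flip_innerₗ] at e2
        exact e2
      rw [e4] at e0
      simpa [e1, Complex.real_smul] using e0.symm
  have h3 : eLpNorm (𝓕 g) 2 volume = eLpNorm (𝓕 G : Lp ℂ 2 (volume : Measure V5)) 2 volume :=
    eLpNorm_congr_ae (by filter_upwards [key] with x hx; exact hx.symm)
  rw [h3, ← eLpNorm_congr_ae h2.coeFn_toLp, ← Lp.enorm_def, ← Lp.enorm_def]
  have := Lp.norm_fourier_eq G
  rw [← ofReal_norm, ← ofReal_norm, this]

lemma eLp2 {X : Type*} [MeasurableSpace X] (μ : Measure X) (g : X → ℂ) :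
    eLpNorm g 2 μ = (∫⁻ x, ‖g x‖ₑ ^ 2 ∂μ) ^ (1/2 : ℝ) := by
  rw [eLpNorm_eq_lintegral_rpow_enorm_toReal (by norm_num) (by norm_num)]
  simp

lemma plancherel_inv (g : V5 → ℂ) (h1 : Integrable g) (h2 : MemLp g 2) :
    ∫⁻ w, ‖𝓕⁻ g w‖ₑ ^ 2 ≤ ∫⁻ x, ‖g x‖ₑ ^ 2 := by
  have h := plancherel_le g h1 h2
  rw [eLp2, eLp2, ENNReal.rpow_le_rpow_iff (by norm_num)] at h
  refine le_trans (le_of_eq ?_) h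
  simp_rw [Real.fourierInv_eq_fourier_neg]
  exact lintegral_neg_eq_self (fun w => ‖𝓕 g w‖ₑ ^ 2)

/-- the exponential -/
def ee (t : ℝ) : ℂ := Complex.exp (2 * (Real.pi : ℂ) * Complex.I * (t : ℂ))

lemma norm_ee (t : ℝ) : ‖ee t‖ = 1 := by
  unfold ee
  rw [show 2 * (Real.pi : ℂ) * Complex.I * (t : ℂ) = ((2 * Real.pi * t : ℝ) : ℂ) * Complex.I by
    push_cast; ring]
  exact Complex.norm_exp_ofReal_mul_I _

lemma cont_ee : Continuous ee := by unfold ee; fun_prop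

lemma ee_add (s t : ℝ) : ee (s + t) = ee s * ee t := by
  unfold ee; rw [← Complex.exp_add]; push_cast; ring_nf

/-- general extension operator -/
def TT {X : Type*} [MeasurableSpace X] (μ : Measure X) (Φ : X → V5) (F : X → ℂ) (x : V5) : ℂ :=
  ∫ w, F w * ee ⟪Φ w, x⟫_ℝ ∂μ

section
variable {X : Type*} [MeasurableSpace X] (μ : Measure X) (Φ : X → V5) (F : X → ℂ)

lemma TT_int (hΦ : Measurable Φ) (hF : Integrable F μ) (x : V5) :
    Integrable (fun w => F w * ee ⟪Φ w, x⟫_ℝ) μ := by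
  refine hF.mul_bdd (c := 1) ?_ ?_
  · exact (cont_ee.measurable.comp (hΦ.inner_const)).aestronglyMeasurable
  · exact Filter.Eventually.of_forall fun w => (norm_ee _).le

lemma TT_cont (hΦ : Measurable Φ) (hF : Integrable F μ) : Continuous (TT μ Φ F) := by
  unfold TT
  apply continuous_of_dominated (bound := fun w => ‖F w‖)
  · exact fun x => (TT_int μ Φ F hΦ hF x).1
  · intro x
    exact Filter.Eventually.of_forall fun w => by simp [norm_ee]
  · exact hF.norm
  · refine Filter.Eventually.of_forall fun w => ?_
    exact continuous_const.mul (cont_ee.comp (by fun_prop))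

lemma TT_bound (x : V5) : ‖TT μ Φ F x‖ₑ ≤ ∫⁻ w, ‖F w‖ₑ ∂μ := by
  refine (enorm_integral_le_lintegral_enorm _).trans (le_of_eq ?_)
  congr with w
  rw [enorm_mul, show ‖ee ⟪Φ w, x⟫_ℝ‖ₑ = 1 by rw [← ofReal_norm, norm_ee]; simp, mul_one]

lemma l2_bound [SFinite μ] (hΦ : Measurable Φ) (D : ℝ≥0∞) (hD : μ.map Φ ≤ D • volume)
    (hF : Integrable F μ) (B : Set V5) (hB : MeasurableSet B) (hBf : volume B ≠ ⊤) :
    ∫⁻ x in B, ‖TT μ Φ F x‖ₑ ^ 2 ≤ D * ∫⁻ w, ‖F w‖ₑ ^ 2 ∂μ := by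
  set T := TT μ Φ F with hT
  have hTc : Continuous T := TT_cont μ Φ F hΦ hF
  set A := ∫⁻ w, ‖F w‖ₑ ∂μ with hA
  have hAf : A < ⊤ := hF.2
  have hTb : ∀ x, ‖T x‖ₑ ≤ A := TT_bound μ Φ F
  set g : V5 → ℂ := B.indicator (fun x => (starRingEnd ℂ) (T x)) with hg
  have hTcc : Continuous (fun x => (starRingEnd ℂ) (T x)) := Complex.continuous_conj.comp hTc
  have hgm : AEStronglyMeasurable g volume := (hTcc.aestronglyMeasurable).indicator hB
  have hgb : ∀ x, ‖g x‖ ≤ A.toReal := by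
    intro x
    have : ‖g x‖ ≤ ‖T x‖ := by
      rw [hg]
      refine (norm_indicator_le_norm_self _ _).trans (by simp)
    refine this.trans ?_
    rw [← toReal_enorm]
    exact ENNReal.toReal_mono hAf.ne (hTb x)
  have hgI : ∀ q : ℝ≥0∞, MemLp g q := by
    intro q
    rw [hg, memLp_indicator_iff_restrict hB]
    have : IsFiniteMeasure (volume.restrict B) := ⟨by simpa using hBf.lt_top⟩
    refine MemLp.of_bound hTcc.aestronglyMeasurable A.toReal ?_
    refine Filter.Eventually.of_forall fun x => ?_
    rw [RCLike.norm_conj, ← toReal_enorm]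
    exact ENNReal.toReal_mono hAf.ne (hTb x)
  have hg1 : Integrable g := memLp_one_iff_integrable.1 (hgI 1)
  set a := ∫⁻ x in B, ‖T x‖ₑ ^ 2 with ha
  have hga : ∫⁻ x, ‖g x‖ₑ ^ 2 = a := by
    rw [ha, ← lintegral_indicator hB]
    congr with x
    by_cases hx : x ∈ B <;> simp [hg, hx]
  have hafin : a ≠ ⊤ := by
    refine ne_top_of_le_ne_top ?_ (lintegral_mono (g := fun _ => A ^ 2) fun x => ?_)
    · rw [lintegral_const]
      exact ENNReal.mul_ne_top (ENNReal.pow_ne_top hAf.ne) (by simpa using hBf)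
    · exact pow_le_pow_left' (hTb x) 2
  have hsw : ∫ x, g x * T x = ∫ w, F w * 𝓕⁻ g (Φ w) ∂μ := by
    have e1 : ∫ x, g x * T x = ∫ x, ∫ w, g x * (F w * ee ⟪Φ w, x⟫_ℝ) ∂μ := by
      congr with x
      rw [hT, TT, ← integral_const_mul]
    rw [e1, integral_integral_swap]
    · congr with w
      rw [Real.fourierInv_eq', ← integral_const_mul]
      congr with x
      rw [real_inner_comm, ee]
      simp only [smul_eq_mul]
      push_cast
      ring_nf
    · have := (hg1.mul_prod hF).mul_bdd (c := 1)
        (g := fun z : V5 × X => ee ⟪Φ z.2, z.1⟫_ℝ) ?_ ?_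
      · refine this.congr (Filter.Eventually.of_forall fun z => ?_)
        simp [Function.uncurry, mul_assoc]
      · refine (cont_ee.measurable.comp ?_).aestronglyMeasurable
        exact (hΦ.comp measurable_snd).inner measurable_fst
      · exact Filter.Eventually.of_forall fun z => (norm_ee _).le
  have hleft : ‖∫ x, g x * T x‖ₑ = a := by
    have : ∀ x, g x * T x = ((‖g x‖ ^ 2 : ℝ) : ℂ) := by
      intro x
      by_cases hx : x ∈ B
      · simp [hg, hx, Complex.conj_mul']
      · simp [hg, hx]
    simp_rw [this]
    rw [integral_complex_ofReal, ← ofReal_norm, Complex.norm_real, Real.norm_of_nonneg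
      (integral_nonneg fun x => by positivity), ofReal_integral_eq_lintegral_ofReal]
    · rw [← hga]
      congr with x
      rw [ENNReal.ofReal_pow (by positivity), ofReal_norm]
    · exact (hgI 2).integrable_norm_pow (by norm_num)
    · exact Filter.Eventually.of_forall fun x => by positivity
  set N := ∫⁻ w, ‖F w‖ₑ ^ 2 ∂μ with hN
  have hgc : Continuous (𝓕⁻ g) := by
    have h : Continuous (𝓕 g) :=
      VectorFourier.fourierIntegral_continuous Real.continuous_fourierChar
        (by exact continuous_inner) hg1
    have : 𝓕⁻ g = fun w => 𝓕 g (-w) := by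
      ext w; rw [Real.fourierInv_eq_fourier_neg]
    rw [this]; exact h.comp continuous_neg
  have hcs : a ≤ N ^ (1/2 : ℝ) * (D * a) ^ (1/2:ℝ) := by
    refine (le_of_eq (by rw [← hleft, hsw])).trans ?_
    refine (enorm_integral_le_lintegral_enorm _).trans ?_
    simp_rw [enorm_mul]
    refine (ENNReal.lintegral_mul_le_Lp_mul_Lq μ Real.HolderConjugate.two_two hF.1.enorm
      ((hgc.measurable.comp hΦ).enorm.aemeasurable)).trans ?_
    have e : ∫⁻ w, ‖𝓕⁻ g (Φ w)‖ₑ ^ 2 ∂μ ≤ D * a := by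
      rw [← lintegral_map (f := fun v => ‖𝓕⁻ g v‖ₑ ^ 2) (by fun_prop) hΦ]
      refine (lintegral_mono' hD le_rfl).trans ?_
      rw [lintegral_smul_measure, smul_eq_mul, ← hga]
      gcongr D * ?_
      exact plancherel_inv g hg1 (hgI 2)
    simp only [Function.comp, ENNReal.rpow_ofNat]
    gcongr
  have h2 : a * a ≤ (D * N) * a := by
    have := mul_le_mul' hcs hcs
    refine this.trans (le_of_eq ?_)
    rw [mul_mul_mul_comm, ← ENNReal.rpow_add_of_nonneg _ _ (by norm_num) (by norm_num),
      ← ENNReal.rpow_add_of_nonneg _ _ (by norm_num) (by norm_num)]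
    norm_num
    ring
  rcases eq_or_ne a 0 with h0 | h0
  · rw [h0]; exact zero_le
  · exact (ENNReal.mul_le_mul_iff_left h0 hafin).1 h2
end

lemma cov_piece (k : ℝ → ℝ≥0∞) (δ u c : ℝ) (hδ : 0 < δ) (s : Set ℝ)
    (hs : MeasurableSet s) (h1 : ∀ x ∈ s, δ < |2 * x - u|)
    (hinj : Set.InjOn (fun x => x ^ 2 + (u - x) ^ 2 + c) s) :
    ∫⁻ x in s, k (x ^ 2 + (u - x) ^ 2 + c) ≤ ENNReal.ofReal (1 / (2 * δ)) * ∫⁻ v, k v := by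
  have h := lintegral_image_eq_lintegral_abs_deriv_mul (f := fun x => x ^ 2 + (u - x) ^ 2 + c)
    (f' := fun x => 2 * (2 * x - u)) hs (fun x _ => by
      refine HasDerivAt.hasDerivWithinAt ?_
      have := ((((hasDerivAt_id x).pow 2).add (((hasDerivAt_id x).const_sub u).pow 2)).add_const c)
      convert! this using 1
      simp; ring) hinj k
  have h2 : ENNReal.ofReal (2 * δ) * ∫⁻ x in s, k (x ^ 2 + (u - x) ^ 2 + c) ≤ ∫⁻ v, k v := by
    rw [← lintegral_const_mul' _ _ ENNReal.ofReal_ne_top]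
    calc _ ≤ ∫⁻ x in s, ENNReal.ofReal |2 * (2 * x - u)| * k (x ^ 2 + (u - x) ^ 2 + c) := by
          refine setLIntegral_mono' hs fun x hx => ?_
          gcongr
          rw [abs_mul, abs_two]
          linarith [h1 x hx]
      _ = _ := h.symm
      _ ≤ _ := setLIntegral_le_lintegral _ _
  calc _ = ENNReal.ofReal (1 / (2 * δ)) * (ENNReal.ofReal (2 * δ) *
        ∫⁻ x in s, k (x ^ 2 + (u - x) ^ 2 + c)) := by
        rw [← mul_assoc, ← ENNReal.ofReal_mul (by positivity),
          one_div_mul_cancel (by positivity)]; simp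
    _ ≤ _ := by gcongr

lemma cov_one (k : ℝ → ℝ≥0∞) (δ u c : ℝ) (hδ : 0 < δ) :
    ∫⁻ x, {x | δ < |2 * x - u|}.indicator (fun x => k (x ^ 2 + (u - x) ^ 2 + c)) x
      ≤ ENNReal.ofReal (1 / δ) * ∫⁻ v, k v := by
  have hm1 : MeasurableSet {x : ℝ | δ < 2 * x - u} :=
    measurableSet_lt (by fun_prop) (by fun_prop)
  have hm2 : MeasurableSet {x : ℝ | δ < -(2 * x - u)} :=
    measurableSet_lt (by fun_prop) (by fun_prop)
  have hU : {x : ℝ | δ < |2 * x - u|} = {x | δ < 2 * x - u} ∪ {x | δ < -(2 * x - u)} := by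
    ext x; simp [lt_abs]
  rw [hU, lintegral_indicator (hm1.union hm2)]
  refine (lintegral_union_le _ _ _).trans ?_
  have a1 := cov_piece k δ u c hδ {x : ℝ | δ < 2 * x - u} hm1
    (fun x hx => lt_of_lt_of_le hx (le_abs_self _)) (by
      intro x hx y hy hxy
      simp only [Set.mem_ofPred_eq] at hx hy hxy
      have : (x - y) * ((2 * x - u) + (2 * y - u)) = 0 := by linear_combination hxy
      rcases mul_eq_zero.1 this with h | h
      · linarith
      · linarith)
  have a2 := cov_piece k δ u c hδ {x : ℝ | δ < -(2 * x - u)} hm2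
    (fun x hx => lt_of_lt_of_le hx (neg_le_abs _)) (by
      intro x hx y hy hxy
      simp only [Set.mem_ofPred_eq] at hx hy hxy
      have : (x - y) * ((2 * x - u) + (2 * y - u)) = 0 := by linear_combination hxy
      rcases mul_eq_zero.1 this with h | h
      · linarith
      · linarith)
  refine (add_le_add a1 a2).trans (le_of_eq ?_)
  rw [← add_mul, ← ENNReal.ofReal_add (by positivity) (by positivity)]
  congr 2
  field_simp; norm_num

lemma cov_two (h : ℝ → ℝ → ℝ≥0∞) (hh : Measurable (Function.uncurry h)) (δ c : ℝ) (hδ : 0 < δ) :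
    ∫⁻ x, ∫⁻ y, (if δ < |x - y| then h (x + y) (x ^ 2 + y ^ 2 + c) else 0)
      ≤ ENNReal.ofReal (1 / δ) * ∫⁻ u, ∫⁻ v, h u v := by
  have e1 : ∀ x, ∫⁻ y, (if δ < |x - y| then h (x + y) (x ^ 2 + y ^ 2 + c) else 0)
      = ∫⁻ u, (if δ < |2 * x - u| then h u (x ^ 2 + (u - x) ^ 2 + c) else 0) := by
    intro x
    rw [← lintegral_add_right_eq_self (μ := volume)
      (fun u => (if δ < |2 * x - u| then h u (x ^ 2 + (u - x) ^ 2 + c) else 0)) x]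
    congr with y
    rw [show 2 * x - (y + x) = x - y by ring, show y + x - x = y by ring, add_comm y x]
  simp_rw [e1]
  rw [lintegral_lintegral_swap, ← lintegral_const_mul' _ _ ENNReal.ofReal_ne_top]
  · refine lintegral_mono fun u => ?_
    refine le_trans (le_of_eq ?_) (cov_one (h u) δ u c hδ)
    congr with x
  · refine Measurable.aemeasurable ?_
    refine Measurable.ite (measurableSet_lt (by fun_prop) (by fun_prop)) ?_ measurable_const
    exact hh.comp (by fun_prop : Measurable fun p : ℝ × ℝ => (p.2, p.1 ^ 2 + (p.2 - p.1) ^ 2 + c))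

lemma lint_succ (n : ℕ) (g : (Fin (n + 1) → ℝ) → ℝ≥0∞) (hg : Measurable g) :
    ∫⁻ ξ, g ξ = ∫⁻ a, ∫⁻ ζ : Fin n → ℝ, g (Matrix.vecCons a ζ) := by
  have mp := (volume_preserving_piFinSuccAbove (fun _ : Fin (n+1) => ℝ) 0).symm
  rw [← mp.lintegral_comp hg]
  rw [Measure.volume_eq_prod, lintegral_prod _ (by exact (hg.comp mp.measurable).aemeasurable)]
  refine lintegral_congr fun a => lintegral_congr fun ζ => congrArg g ?_
  ext i
  refine Fin.cases ?_ (fun j => ?_) i <;> simp [MeasurableEquiv.piFinSuccAbove]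

lemma lint_zero (g : (Fin 0 → ℝ) → ℝ≥0∞) : ∫⁻ ξ, g ξ = g ![] := by
  rw [Measure.volume_pi_eq_dirac ![], lintegral_dirac]

lemma meas_vecCons {n : ℕ} (a : ℝ) : Measurable (fun ζ : Fin n → ℝ => (Matrix.vecCons a ζ : Fin (n+1) → ℝ)) := by
  refine measurable_pi_lambda _ fun i => ?_
  refine Fin.cases ?_ (fun j => ?_) i
  · simp
  · simpa using measurable_pi_apply j

lemma lint_three (g : (Fin 3 → ℝ) → ℝ≥0∞) (hg : Measurable g) :
    ∫⁻ ξ, g ξ = ∫⁻ a, ∫⁻ b, ∫⁻ c, g ![a, b, c] := by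
  rw [lint_succ _ _ hg]
  refine lintegral_congr fun a => ?_
  have h1 := hg.comp (meas_vecCons a)
  refine (lint_succ _ _ h1).trans (lintegral_congr fun b => ?_)
  have h2 := h1.comp (meas_vecCons b)
  refine (lint_succ _ _ h2).trans (lintegral_congr fun c => ?_)
  exact lint_zero _

lemma lint_five (g : V5 → ℝ≥0∞) (hg : Measurable g) :
    ∫⁻ ξ, g ξ = ∫⁻ a, ∫⁻ b, ∫⁻ c, ∫⁻ d, ∫⁻ e, g !₂[a, b, c, d, e] := by
  have hm : Measurable (fun x : Fin 5 → ℝ => (WithLp.toLp 2 x : V5)) :=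
    (PiLp.volume_preserving_toLp (Fin 5)).measurable
  rw [← (PiLp.volume_preserving_toLp (Fin 5)).lintegral_comp hg]
  have h0 := hg.comp hm
  refine (lint_succ _ _ h0).trans (lintegral_congr fun a => ?_)
  have h1 := h0.comp (meas_vecCons a)
  refine (lint_succ _ _ h1).trans (lintegral_congr fun b => ?_)
  have h2 := h1.comp (meas_vecCons b)
  refine (lint_succ _ _ h2).trans (lintegral_congr fun c => ?_)
  have h3 := h2.comp (meas_vecCons c)
  refine (lint_succ _ _ h3).trans (lintegral_congr fun d => ?_)
  have h4 := h3.comp (meas_vecCons d)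
  refine (lint_succ _ _ h4).trans (lintegral_congr fun e => ?_)
  exact lint_zero _

lemma cov_six (h : ℝ → ℝ → ℝ → ℝ → ℝ → ℝ≥0∞)
    (hh : Measurable fun p : ℝ × ℝ × ℝ × ℝ × ℝ => h p.1 p.2.1 p.2.2.1 p.2.2.2.1 p.2.2.2.2)
    (δ₁ δ₂ : ℝ) (h1 : 0 < δ₁) (h2 : 0 < δ₂) :
    ∫⁻ a, ∫⁻ b, ∫⁻ c, ∫⁻ a', ∫⁻ b', ∫⁻ c',
      (if δ₁ < |a - a'| then (if b' ∈ Set.Icc (0:ℝ) 1 then (if δ₂ < |c - c'| then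
        h (a + a') (b + b') (c + c') (c ^ 2 + c' ^ 2 + (a * b + a' * b')) (a ^ 2 + a' ^ 2 + 0)
        else 0) else 0) else 0) ≤
    ENNReal.ofReal (1 / (δ₁ * δ₂)) * ∫⁻ a, ∫⁻ b, ∫⁻ c, ∫⁻ d, ∫⁻ e, h a b c d e := by
  set G : ℝ → ℝ → ℝ → ℝ → ℝ → ℝ → ℝ≥0∞ := fun a b c a' b' c' =>
      (if δ₁ < |a - a'| then (if b' ∈ Set.Icc (0:ℝ) 1 then (if δ₂ < |c - c'| then
        h (a + a') (b + b') (c + c') (c ^ 2 + c' ^ 2 + (a * b + a' * b')) (a ^ 2 + a' ^ 2 + 0)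
        else 0) else 0) else 0) with hG
  have hGm : Measurable fun p : ℝ × ℝ × ℝ × ℝ × ℝ × ℝ =>
      G p.1 p.2.1 p.2.2.1 p.2.2.2.1 p.2.2.2.2.1 p.2.2.2.2.2 := by
    refine Measurable.ite (measurableSet_lt (by fun_prop) (by fun_prop)) ?_ measurable_const
    refine Measurable.ite ?_ ?_ measurable_const
    · exact measurableSet_Icc.preimage (f := fun p : ℝ × ℝ × ℝ × ℝ × ℝ × ℝ => p.2.2.2.2.1)
        (by fun_prop)
    refine Measurable.ite (measurableSet_lt (by fun_prop) (by fun_prop)) ?_ measurable_const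
    exact hh.comp (f := fun p : ℝ × ℝ × ℝ × ℝ × ℝ × ℝ => (p.1 + p.2.2.2.1, p.2.1 + p.2.2.2.2.1,
      p.2.2.1 + p.2.2.2.2.2, p.2.2.1 ^ 2 + p.2.2.2.2.2 ^ 2 + (p.1 * p.2.1 + p.2.2.2.1 * p.2.2.2.2.1),
      p.1 ^ 2 + p.2.2.2.1 ^ 2 + 0)) (by fun_prop)
  have hGc : ∀ {α : Type} [MeasurableSpace α] {u1 u2 u3 u4 u5 u6 : α → ℝ}, Measurable u1 →
      Measurable u2 → Measurable u3 → Measurable u4 → Measurable u5 → Measurable u6 →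
      Measurable fun x => G (u1 x) (u2 x) (u3 x) (u4 x) (u5 x) (u6 x) := by
    intro α _ u1 u2 u3 u4 u5 u6 m1 m2 m3 m4 m5 m6
    exact hGm.comp (m1.prodMk (m2.prodMk (m3.prodMk (m4.prodMk (m5.prodMk m6)))))
  have hhc : ∀ {α : Type} [MeasurableSpace α] {u1 u2 u3 u4 u5 : α → ℝ}, Measurable u1 →
      Measurable u2 → Measurable u3 → Measurable u4 → Measurable u5 →
      Measurable fun x => h (u1 x) (u2 x) (u3 x) (u4 x) (u5 x) := by
    intro α _ u1 u2 u3 u4 u5 m1 m2 m3 m4 m5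
    exact hh.comp (m1.prodMk (m2.prodMk (m3.prodMk (m4.prodMk m5))))
  have s1 : ∫⁻ a, ∫⁻ b, ∫⁻ c, ∫⁻ a', ∫⁻ b', ∫⁻ c', G a b c a' b' c' =
      ∫⁻ a, ∫⁻ a', ∫⁻ b', ∫⁻ b, ∫⁻ c, ∫⁻ c', G a b c a' b' c' := by
    refine lintegral_congr fun a => ?_
    calc _ = ∫⁻ b, ∫⁻ a', ∫⁻ c, ∫⁻ b', ∫⁻ c', G a b c a' b' c' := by
            refine lintegral_congr fun b => ?_
            refine lintegral_lintegral_swap (Measurable.aemeasurable ?_)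
            refine Measurable.lintegral_prod_right (Measurable.lintegral_prod_right ?_)
            apply hGc <;> fun_prop
      _ = ∫⁻ b, ∫⁻ a', ∫⁻ b', ∫⁻ c, ∫⁻ c', G a b c a' b' c' := by
            refine lintegral_congr fun b => lintegral_congr fun a' => ?_
            refine lintegral_lintegral_swap (Measurable.aemeasurable ?_)
            refine Measurable.lintegral_prod_right ?_
            apply hGc <;> fun_prop
      _ = ∫⁻ a', ∫⁻ b, ∫⁻ b', ∫⁻ c, ∫⁻ c', G a b c a' b' c' := by
            refine lintegral_lintegral_swap (Measurable.aemeasurable ?_)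
            refine Measurable.lintegral_prod_right (Measurable.lintegral_prod_right
              (Measurable.lintegral_prod_right ?_))
            apply hGc <;> fun_prop
      _ = _ := by
            refine lintegral_congr fun a' => ?_
            refine lintegral_lintegral_swap (Measurable.aemeasurable ?_)
            refine Measurable.lintegral_prod_right (Measurable.lintegral_prod_right ?_)
            apply hGc <;> fun_prop
  rw [s1]
  set H : ℝ → ℝ → ℝ≥0∞ := fun s t => ∫⁻ b, ∫⁻ u, ∫⁻ v, h s b u v t with hH
  have hHm : Measurable (Function.uncurry H) := by
    refine Measurable.lintegral_prod_right (Measurable.lintegral_prod_right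
              (Measurable.lintegral_prod_right ?_))
    apply hhc <;> fun_prop
  have s2 : ∀ a a', ∫⁻ b', ∫⁻ b, ∫⁻ c, ∫⁻ c', G a b c a' b' c' ≤
      ENNReal.ofReal (1 / δ₂) * (if δ₁ < |a - a'| then H (a + a') (a ^ 2 + a' ^ 2 + 0) else 0) := by
    intro a a'
    by_cases ha : δ₁ < |a - a'|
    swap
    · simp [hG, ha]
    simp only [ha, if_true]
    have s3 : ∀ b', ∫⁻ b, ∫⁻ c, ∫⁻ c', G a b c a' b' c' ≤ (Set.Icc (0:ℝ) 1).indicator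
        (fun _ => ENNReal.ofReal (1 / δ₂) * H (a + a') (a ^ 2 + a' ^ 2 + 0)) b' := by
      intro b'
      by_cases hb : b' ∈ Set.Icc (0:ℝ) 1
      swap
      · have hz : ∀ b c c', G a b c a' b' c' = 0 := by
          intro b c c'
          simp only [hG, hb, if_false, ite_self]
        simp [hz]
      rw [Set.indicator_of_mem hb]
      calc _ ≤ ∫⁻ b, ENNReal.ofReal (1 / δ₂) * ∫⁻ u, ∫⁻ v, h (a + a') (b + b') u v (a ^ 2 + a' ^ 2 + 0) := by
            refine lintegral_mono fun b => ?_
            simp only [hG, ha, hb, if_true]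
            refine cov_two (fun u v => h (a + a') (b + b') u v (a ^ 2 + a' ^ 2 + 0)) ?_ δ₂ _ h2
            apply hhc <;> fun_prop
        _ = _ := by
            rw [lintegral_const_mul' _ _ ENNReal.ofReal_ne_top]
            congr 1
            exact lintegral_add_right_eq_self
              (fun b => ∫⁻ u, ∫⁻ v, h (a + a') b u v (a ^ 2 + a' ^ 2 + 0)) b'
    refine (lintegral_mono s3).trans ?_
    rw [lintegral_indicator measurableSet_Icc, lintegral_const]
    simp
  refine (lintegral_mono fun a => lintegral_mono fun a' => s2 a a').trans ?_
  simp_rw [lintegral_const_mul' _ _ ENNReal.ofReal_ne_top]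
  refine (mul_le_mul_right (cov_two H hHm δ₁ 0 h1) _).trans (le_of_eq ?_)
  rw [← mul_assoc, ← ENNReal.ofReal_mul (by positivity)]
  congr 1
  · congr 1; field_simp
  refine lintegral_congr fun a => ?_
  calc ∫⁻ e, ∫⁻ b, ∫⁻ c, ∫⁻ d, h a b c d e = ∫⁻ b, ∫⁻ e, ∫⁻ c, ∫⁻ d, h a b c d e := by
            refine lintegral_lintegral_swap (Measurable.aemeasurable ?_)
            refine Measurable.lintegral_prod_right (Measurable.lintegral_prod_right ?_)
            apply hhc <;> fun_prop
    _ = ∫⁻ b, ∫⁻ c, ∫⁻ e, ∫⁻ d, h a b c d e := by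
            refine lintegral_congr fun b => ?_
            refine lintegral_lintegral_swap (Measurable.aemeasurable ?_)
            refine Measurable.lintegral_prod_right ?_
            apply hhc <;> fun_prop
    _ = _ := by
            refine lintegral_congr fun b => lintegral_congr fun c => ?_
            refine lintegral_lintegral_swap (Measurable.aemeasurable ?_)
            apply hhc <;> fun_prop

/-- parametrization of the surface -/
def phi (ξ : Fin 3 → ℝ) : V5 := !₂[ξ 0, ξ 1, ξ 2, ξ 0 * ξ 1 + ξ 2 ^ 2, ξ 0 ^ 2]

/-- sum map -/
def Phi (z : (Fin 3 → ℝ) × (Fin 3 → ℝ)) : V5 := phi z.1 + phi z.2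

lemma meas_phi : Measurable phi := by
  refine (PiLp.volume_preserving_toLp (Fin 5)).measurable.comp
    (f := fun ξ : Fin 3 → ℝ => ![ξ 0, ξ 1, ξ 2, ξ 0 * ξ 1 + ξ 2 ^ 2, ξ 0 ^ 2]) ?_
  refine measurable_pi_lambda _ fun i => ?_
  fin_cases i <;> simp <;> fun_prop

lemma meas_Phi : Measurable Phi :=
  (meas_phi.comp measurable_fst).add (meas_phi.comp measurable_snd)

lemma map_le (A : Set (Fin 3 → ℝ)) (hA : MeasurableSet A) (hA3 : A ⊆ cube3)
    (S : Set ((Fin 3 → ℝ) × (Fin 3 → ℝ))) (hS : MeasurableSet S)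
    (δ₁ δ₂ : ℝ) (h1 : 0 < δ₁) (h2 : 0 < δ₂)
    (hSd : ∀ z ∈ S, δ₁ < |z.1 0 - z.2 0| ∧ δ₂ < |z.1 2 - z.2 2|) :
    ((((volume.restrict A).prod (volume.restrict A)).restrict S).map Phi) ≤
      ENNReal.ofReal (1 / (δ₁ * δ₂)) • volume := by
  refine Measure.le_iff.2 fun B hB => ?_
  rw [Measure.map_apply meas_Phi hB, Measure.restrict_apply (meas_Phi hB), Measure.prod_restrict,
    Measure.restrict_apply ((meas_Phi hB).inter hS)]
  set Q := Phi ⁻¹' B ∩ S ∩ A ×ˢ A with hQ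
  have hQm : MeasurableSet Q := ((meas_Phi hB).inter hS).inter (hA.prod hA)
  set h : ℝ → ℝ → ℝ → ℝ → ℝ → ℝ≥0∞ := fun a b c d e => B.indicator (fun _ => 1) (!₂[a, b, c, d, e]) with hh
  have hBm : Measurable (B.indicator (fun _ => (1 : ℝ≥0∞))) := measurable_const.indicator hB
  have hhm : Measurable fun p : ℝ × ℝ × ℝ × ℝ × ℝ => h p.1 p.2.1 p.2.2.1 p.2.2.2.1 p.2.2.2.2 := by
    refine hBm.comp ?_
    refine (PiLp.volume_preserving_toLp (Fin 5)).measurable.comp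
      (f := fun p : ℝ × ℝ × ℝ × ℝ × ℝ => ![p.1, p.2.1, p.2.2.1, p.2.2.2.1, p.2.2.2.2]) ?_
    refine measurable_pi_lambda _ fun i => ?_
    fin_cases i <;> simp <;> fun_prop
  have k := cov_six h hhm δ₁ δ₂ h1 h2
  have e5 : ∫⁻ a, ∫⁻ b, ∫⁻ c, ∫⁻ d, ∫⁻ e, h a b c d e = volume B := by
    rw [← lint_five _ hBm, lintegral_indicator_const hB, one_mul]
  rw [e5] at k
  rw [Measure.smul_apply, smul_eq_mul]
  refine le_trans ?_ k
  have hQi : Measurable (Q.indicator (fun _ => (1 : ℝ≥0∞))) := measurable_const.indicator hQm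
  rw [← one_mul ((volume.prod volume) Q), ← lintegral_indicator_const hQm,
    lintegral_prod _ hQi.aemeasurable, lint_three _ (Measurable.lintegral_prod_right' hQi)]
  refine lintegral_mono fun a => lintegral_mono fun b => lintegral_mono fun c => ?_
  dsimp only
  refine le_trans (le_of_eq (lint_three (fun y => Q.indicator (fun _ => 1) (![a, b, c], y))
    (hQi.comp (measurable_const.prodMk measurable_id)))) ?_
  refine lintegral_mono fun a' => lintegral_mono fun b' => lintegral_mono fun c' => ?_
  by_cases hq : (![a, b, c], ![a', b', c']) ∈ Q
  swap
  · simp [hq]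
  rw [Set.indicator_of_mem hq]
  obtain ⟨⟨hb, hs⟩, -, hq2⟩ := hq
  have hs' := hSd _ hs
  simp only [Matrix.cons_val_zero, Matrix.cons_val] at hs'
  have hc : ![a', b', c'] ∈ Set.Icc (fun _ => (0:ℝ)) (fun _ => 1) := hA3 hq2
  have hb' : b' ∈ Set.Icc (0:ℝ) 1 := ⟨hc.1 1, hc.2 1⟩
  rw [if_pos hs'.1, if_pos hb', if_pos hs'.2]
  have : Phi (![a, b, c], ![a', b', c']) = !₂[a + a', b + b', c + c',
      c ^ 2 + c' ^ 2 + (a * b + a' * b'), a ^ 2 + a' ^ 2 + 0] := by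
    ext i
    fin_cases i <;> simp [Phi, phi]
    ring
  rw [Set.mem_preimage, this] at hb
  simp only [hh]
  rw [Set.indicator_of_mem hb]

lemma eLp_nat {X : Type*} [MeasurableSpace X] (ν : Measure X) (g : X → ℂ) (n : ℕ) (hn : n ≠ 0) :
    eLpNorm g n ν ^ n = ∫⁻ x, ‖g x‖ₑ ^ n ∂ν := by
  rw [eLpNorm_eq_lintegral_rpow_enorm_toReal (by simpa using hn) (by simp)]
  simp only [ENNReal.toReal_natCast, ENNReal.rpow_natCast]
  rw [← ENNReal.rpow_natCast, ← ENNReal.rpow_mul, one_div_mul_cancel (by exact_mod_cast hn),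
    ENNReal.rpow_one]

lemma eLp_hasSum {X : Type*} [MeasurableSpace X] (ν : Measure X) (q : ℝ≥0∞) (hq : 1 ≤ q)
    (f : ℕ × ℕ → X → ℂ) (hf : ∀ i, AEStronglyMeasurable (f i) ν) (g : X → ℂ)
    (h : ∀ x, HasSum (fun i => f i x) (g x)) :
    eLpNorm g q ν ≤ ∑' i, eLpNorm (f i) q ν := by
  set e : ℕ ≃ ℕ × ℕ := Nat.pairEquiv.symm
  have ht : ∀ x, Filter.Tendsto (fun n => (∑ i ∈ Finset.range n, f (e i)) x) Filter.atTop
      (nhds (g x)) := by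
    intro x
    have := (e.hasSum_iff.2 (h x)).tendsto_sum_nat
    simpa [Finset.sum_apply] using this
  refine (Lp.eLpNorm_lim_le_liminf_eLpNorm (f := fun n => ∑ i ∈ Finset.range n, f (e i)) ?_ g
    (Filter.Eventually.of_forall ht)).trans ?_
  · intro n
    exact Finset.aestronglyMeasurable_sum _ fun i _ => hf _
  refine Filter.liminf_le_of_frequently_le' (Filter.Frequently.of_forall fun n => ?_)
  refine (eLpNorm_sum_le (fun i _ => hf _) hq).trans ?_
  rw [← e.tsum_eq]
  exact ENNReal.sum_le_tsum _

/-- dyadic pieces -/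
def SS (r s : ℝ) : Set ((Fin 3 → ℝ) × (Fin 3 → ℝ)) :=
  {z | (r / 2 < |z.1 0 - z.2 0| ∧ |z.1 0 - z.2 0| ≤ r) ∧
    (s / 2 < |z.1 2 - z.2 2| ∧ |z.1 2 - z.2 2| ≤ s)}

lemma meas_SS (r s : ℝ) : MeasurableSet (SS r s) := by
  have m0 : Measurable fun z : (Fin 3 → ℝ) × (Fin 3 → ℝ) => |z.1 0 - z.2 0| := by fun_prop
  have m2 : Measurable fun z : (Fin 3 → ℝ) × (Fin 3 → ℝ) => |z.1 2 - z.2 2| := by fun_prop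
  exact ((measurableSet_lt measurable_const m0).inter (measurableSet_le m0 measurable_const)).inter
    ((measurableSet_lt measurable_const m2).inter (measurableSet_le m2 measurable_const))

lemma slice_le (A : Set (Fin 3 → ℝ)) (hA3 : A ⊆ cube3) (r s : ℝ) (hr : 0 < r) (hs : 0 < s)
    (ξ : Fin 3 → ℝ) (T : Set (Fin 3 → ℝ)) (hT : MeasurableSet T)
    (h : ∀ η ∈ T, |ξ 0 - η 0| ≤ r ∧ |ξ 2 - η 2| ≤ s) :
    (volume.restrict A) T ≤ ENNReal.ofReal (4 * r * s) := by
  rw [Measure.restrict_apply hT]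
  have : T ∩ A ⊆ Set.Icc ![ξ 0 - r, 0, ξ 2 - s] ![ξ 0 + r, 1, ξ 2 + s] := by
    rintro η ⟨h1, h2⟩
    have h3 := h η h1
    have h4 : η ∈ Set.Icc (fun _ => (0:ℝ)) (fun _ => 1) := hA3 h2
    rw [abs_le, abs_le] at h3
    constructor
    · intro i
      fin_cases i
      · simp; linarith
      · exact h4.1 1
      · simp; linarith
    · intro i
      fin_cases i
      · simp; linarith
      · exact h4.2 1
      · simp; linarith
  refine (measure_mono this).trans (le_of_eq ?_)
  rw [Real.volume_Icc_pi, Fin.prod_univ_three, ← ENNReal.ofReal_mul (by simp; linarith),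
    ← ENNReal.ofReal_mul (by simp; linarith)]
  congr 1
  simp
  ring

lemma schur (A : Set (Fin 3 → ℝ)) (hA3 : A ⊆ cube3) (r s : ℝ) (hr : 0 < r) (hs : 0 < s)
    (h : (Fin 3 → ℝ) → ℝ≥0∞) (hh : Measurable h) :
    ∫⁻ z in SS r s, h z.1 * h z.2 ∂((volume.restrict A).prod (volume.restrict A)) ≤
      ENNReal.ofReal (8 * r * s) * ∫⁻ ξ in A, h ξ ^ 2 := by
  set μ := volume.restrict A
  have e1 : ∀ z : (Fin 3 → ℝ) × (Fin 3 → ℝ), h z.1 * h z.2 ≤ h z.1 ^ 2 + h z.2 ^ 2 := by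
    intro z
    rcases le_total (h z.1) (h z.2) with hz | hz
    · refine le_trans ?_ le_add_self
      rw [sq]; gcongr
    · refine le_trans ?_ le_self_add
      rw [sq]; gcongr
  have m1 : Measurable fun z : (Fin 3 → ℝ) × (Fin 3 → ℝ) => h z.1 ^ 2 := by fun_prop
  have m2 : Measurable fun z : (Fin 3 → ℝ) × (Fin 3 → ℝ) => h z.2 ^ 2 := by fun_prop
  refine (lintegral_mono e1).trans ?_
  rw [lintegral_add_left m1, ← lintegral_indicator (meas_SS r s),
    ← lintegral_indicator (meas_SS r s),
    lintegral_prod _ (m1.indicator (meas_SS r s)).aemeasurable,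
    lintegral_prod_symm _ (m2.indicator (meas_SS r s)).aemeasurable]
  have k1 : ∀ ξ, ∫⁻ η, (SS r s).indicator (fun z => h z.1 ^ 2) (ξ, η) ∂μ ≤
      ENNReal.ofReal (4 * r * s) * h ξ ^ 2 := by
    intro ξ
    have hm : MeasurableSet {η | (ξ, η) ∈ SS r s} := measurable_prodMk_left (meas_SS r s)
    have : ∀ η, (SS r s).indicator (fun z => h z.1 ^ 2) (ξ, η) =
        {η | (ξ, η) ∈ SS r s}.indicator (fun _ => h ξ ^ 2) η := by
      intro η; rfl
    simp_rw [this]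
    rw [lintegral_indicator_const hm, mul_comm]
    gcongr
    exact slice_le A hA3 r s hr hs ξ _ hm fun η hη => ⟨hη.1.2, hη.2.2⟩
  have k2 : ∀ ξ, ∫⁻ η, (SS r s).indicator (fun z => h z.2 ^ 2) (η, ξ) ∂μ ≤
      ENNReal.ofReal (4 * r * s) * h ξ ^ 2 := by
    intro ξ
    have hm : MeasurableSet {η | (η, ξ) ∈ SS r s} := measurable_prodMk_right (meas_SS r s)
    have : ∀ η, (SS r s).indicator (fun z => h z.2 ^ 2) (η, ξ) =
        {η | (η, ξ) ∈ SS r s}.indicator (fun _ => h ξ ^ 2) η := by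
      intro η; rfl
    simp_rw [this]
    rw [lintegral_indicator_const hm, mul_comm]
    gcongr
    refine slice_le A hA3 r s hr hs ξ _ hm fun η hη => ⟨?_, ?_⟩
    · rw [abs_sub_comm]; exact hη.1.2
    · rw [abs_sub_comm]; exact hη.2.2
  refine (add_le_add (lintegral_mono k1) (lintegral_mono k2)).trans (le_of_eq ?_)
  rw [lintegral_const_mul' _ _ ENNReal.ofReal_ne_top, ← add_mul,
    ← ENNReal.ofReal_add (by positivity) (by positivity)]
  congr 2; ring

lemma piece (A : Set (Fin 3 → ℝ)) (hA : MeasurableSet A) (hA3 : A ⊆ cube3) (r s : ℝ)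
    (hr : 0 < r) (hs : 0 < s) (g : (Fin 3 → ℝ) → ℂ) (hg : Measurable g)
    (hgI : Integrable g (volume.restrict A))
    (q : ℝ) (hq : 2 < q) (N : ℝ≥0∞)
    (h2 : ∫⁻ ξ in A, ‖g ξ‖ₑ ^ 2 ≤ N ^ 2) (h4 : ∫⁻ ξ in A, ‖g ξ‖ₑ ^ 4 ≤ N ^ 4)
    (B : Set V5) (hB : MeasurableSet B) (hBf : volume B ≠ ⊤) :
    eLpNorm (TT (((volume.restrict A).prod (volume.restrict A)).restrict (SS r s)) Phi
      (fun z => g z.1 * g z.2)) (ENNReal.ofReal q) (volume.restrict B) ≤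
      ENNReal.ofReal (256 * (r * s) ^ (1 - 2 / q)) * N ^ 2 := by
  set μ := volume.restrict A
  set F : (Fin 3 → ℝ) × (Fin 3 → ℝ) → ℂ := fun z => g z.1 * g z.2 with hF
  set T := TT ((μ.prod μ).restrict (SS r s)) Phi F with hT
  have hFI : Integrable F (μ.prod μ) := hgI.mul_prod hgI
  have b1 : ∀ x, ‖T x‖ₑ ≤ ENNReal.ofReal (8 * r * s) * N ^ 2 := by
    intro x
    refine (TT_bound _ _ _ x).trans ?_
    simp only [hF, enorm_mul]
    refine (schur A hA3 r s hr hs (fun ξ => ‖g ξ‖ₑ) hg.enorm).trans ?_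
    gcongr
  have b2 : ∫⁻ x in B, ‖T x‖ₑ ^ 2 ≤ 32 * N ^ 4 := by
    refine (l2_bound _ Phi F meas_Phi _ (map_le A hA hA3 (SS r s) (meas_SS r s) (r / 2) (s / 2)
      (by positivity) (by positivity) (fun z hz => ⟨hz.1.1, hz.2.1⟩)) hFI.restrict B hB hBf).trans ?_
    have : ∫⁻ z in SS r s, ‖F z‖ₑ ^ 2 ∂(μ.prod μ) ≤ ENNReal.ofReal (8 * r * s) * N ^ 4 := by
      simp only [hF, enorm_mul, mul_pow]
      refine (schur A hA3 r s hr hs (fun ξ => ‖g ξ‖ₑ ^ 2) (hg.enorm.pow_const 2)).trans ?_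
      gcongr ENNReal.ofReal (8 * r * s) * ?_
      refine le_trans (le_of_eq ?_) h4
      congr with ξ
      ring
    refine (mul_le_mul_right this _).trans (le_of_eq ?_)
    rw [← mul_assoc, ← ENNReal.ofReal_mul (by positivity)]
    congr 1
    rw [show 1 / (r / 2 * (s / 2)) * (8 * r * s) = 32 by field_simp; norm_num]
    simp
  have b3 : ∫⁻ x in B, ‖T x‖ₑ ^ q ≤ (ENNReal.ofReal (8 * r * s) * N ^ 2) ^ (q - 2) * (32 * N ^ 4) := by
    calc _ ≤ ∫⁻ x in B, (ENNReal.ofReal (8 * r * s) * N ^ 2) ^ (q - 2) * ‖T x‖ₑ ^ 2 := by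
          refine lintegral_mono fun x => ?_
          rw [show q = (q - 2) + (2:ℕ) by push_cast; ring,
            ENNReal.rpow_add_of_nonneg _ _ (by linarith) (by norm_num), ENNReal.rpow_natCast]
          simp only [Nat.cast_ofNat, add_sub_cancel_right]
          gcongr
          exact b1 x
      _ = (ENNReal.ofReal (8 * r * s) * N ^ 2) ^ (q - 2) * ∫⁻ x in B, ‖T x‖ₑ ^ 2 := by
          refine lintegral_const_mul _ ?_
          exact ((TT_cont _ _ _ meas_Phi hFI.restrict).measurable.enorm).pow_const 2
      _ ≤ _ := by gcongr
  have hq0 : 0 < q := by linarith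
  rw [eLpNorm_eq_lintegral_rpow_enorm_toReal (by simpa using hq0) (by simp),
    ENNReal.toReal_ofReal hq0.le]
  refine (ENNReal.rpow_le_rpow b3 (by positivity)).trans ?_
  have hθ : 0 ≤ 1 - 2 / q := by
    rw [sub_nonneg, div_le_one hq0]; exact hq.le
  have hθ1 : 1 - 2 / q ≤ 1 := by
    have : 0 ≤ 2 / q := by positivity
    linarith
  have hq1 : 1 / q ≤ 1 := by rw [div_le_one hq0]; linarith
  rw [ENNReal.mul_rpow_of_nonneg _ _ (by positivity), ← ENNReal.rpow_mul,
    show (q - 2) * (1 / q) = 1 - 2 / q by field_simp,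
    ENNReal.mul_rpow_of_nonneg _ _ hθ, ENNReal.mul_rpow_of_nonneg _ _ (by positivity)]
  have n1 : (N ^ 2) ^ (1 - 2 / q) * (N ^ 4) ^ (1 / q) = N ^ 2 := by
    rw [← ENNReal.rpow_natCast, ← ENNReal.rpow_natCast, ← ENNReal.rpow_mul, ← ENNReal.rpow_mul,
      ← ENNReal.rpow_add_of_nonneg _ _ (by positivity) (by positivity)]
    congr 1
    push_cast
    field_simp
    ring
  have n2 : ENNReal.ofReal (8 * r * s) ^ (1 - 2 / q) * 32 ^ (1 / q) ≤
      ENNReal.ofReal (256 * (r * s) ^ (1 - 2 / q)) := by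
    rw [show (32 : ℝ≥0∞) = ENNReal.ofReal 32 by simp,
      ENNReal.ofReal_rpow_of_nonneg (by positivity) hθ,
      ENNReal.ofReal_rpow_of_nonneg (by positivity) (by positivity),
      ← ENNReal.ofReal_mul (by positivity)]
    apply ENNReal.ofReal_le_ofReal
    rw [mul_assoc 8 r s, Real.mul_rpow (by norm_num) (by positivity)]
    have c1 : (8:ℝ) ^ (1 - 2 / q) ≤ 8 := by
      simpa using Real.rpow_le_rpow_of_exponent_le (by norm_num : (1:ℝ) ≤ 8) hθ1
    have c2 : (32:ℝ) ^ (1 / q) ≤ 32 := by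
      simpa using Real.rpow_le_rpow_of_exponent_le (by norm_num : (1:ℝ) ≤ 32) hq1
    calc _ ≤ 8 * (r * s) ^ (1 - 2 / q) * 32 := by gcongr
      _ = _ := by ring
  calc _ = (ENNReal.ofReal (8 * r * s) ^ (1 - 2 / q) * 32 ^ (1 / q)) *
        ((N ^ 2) ^ (1 - 2 / q) * (N ^ 4) ^ (1 / q)) := by ring
    _ ≤ _ := by rw [n1]; gcongr

lemma diag_null (A : Set (Fin 3 → ℝ)) (i : Fin 3) :
    ∀ᵐ z ∂((volume.restrict A).prod (volume.restrict A)), z.1 i ≠ z.2 i := by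
  have hm : MeasurableSet {z : (Fin 3 → ℝ) × (Fin 3 → ℝ) | z.1 i = z.2 i} :=
    measurableSet_eq_fun (by fun_prop) (by fun_prop)
  have : ((volume.restrict A).prod (volume.restrict A)) {z | z.1 i = z.2 i} = 0 := by
    rw [Measure.measure_prod_null hm]
    refine Filter.Eventually.of_forall fun ξ => ?_
    refine le_antisymm ?_ zero_le
    refine (Measure.restrict_apply_le _ _).trans ?_
    have h := Measure.pi_hyperplane (fun _ : Fin 3 => (volume : Measure ℝ)) i (ξ i)
    rw [← volume_pi] at h
    refine le_trans (le_of_eq ?_) h.le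
    congr 1
    ext η
    simp [eq_comm]
  rw [ae_iff]
  simpa using this

lemma dyadic (d t : ℝ) (hd : 0 < d) (h0 : 0 < t) (h1 : t ≤ d) :
    ∃ j : ℕ, (1 / 2 : ℝ) ^ j * d / 2 < t ∧ t ≤ (1 / 2 : ℝ) ^ j * d := by
  obtain ⟨n, h2, h3⟩ := exists_nat_pow_near_of_lt_one (x := t / d) (y := (1 / 2 : ℝ)) (by positivity)
    ((div_le_one hd).2 h1) (by norm_num) (by norm_num)
  refine ⟨n, ?_, ?_⟩
  · rw [lt_div_iff₀ hd] at h2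
    rw [pow_succ] at h2
    linarith
  · rwa [div_le_iff₀ hd] at h3

lemma dyadic_disj (d t : ℝ) (hd : 0 < d) (i j : ℕ)
    (hi : (1 / 2 : ℝ) ^ i * d / 2 < t ∧ t ≤ (1 / 2 : ℝ) ^ i * d)
    (hj : (1 / 2 : ℝ) ^ j * d / 2 < t ∧ t ≤ (1 / 2 : ℝ) ^ j * d) : i = j := by
  have key : ∀ i j : ℕ, (1 / 2 : ℝ) ^ i * d / 2 < t → t ≤ (1 / 2 : ℝ) ^ j * d → j ≤ i := by
    intro i j hi hj
    by_contra h
    have h' : i + 1 ≤ j := by omega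
    have : (1 / 2 : ℝ) ^ j ≤ (1 / 2 : ℝ) ^ (i + 1) :=
      pow_le_pow_of_le_one (by norm_num) (by norm_num) h'
    have := mul_le_mul_of_nonneg_right this hd.le
    rw [pow_succ] at this
    linarith
  exact le_antisymm (key j i hj.1 hi.2) (key i j hi.1 hj.2)

lemma sq_hasSum (A : Set (Fin 3 → ℝ)) (hA : MeasurableSet A) (hA3 : A ⊆ cube3) (d a : ℝ)
    (hd : 0 < d) (hAd : ∀ ξ ∈ A, ξ 0 ∈ Set.Icc a (a + d)) (g : (Fin 3 → ℝ) → ℂ)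
    (hgI : Integrable g (volume.restrict A)) (x : V5) :
    HasSum (fun i : ℕ × ℕ => TT (((volume.restrict A).prod (volume.restrict A)).restrict
      (SS ((1 / 2 : ℝ) ^ i.1 * d) ((1 / 2 : ℝ) ^ i.2 * 1))) Phi (fun z => g z.1 * g z.2) x)
      (TT (volume.restrict A) phi g x ^ 2) := by
  set μ := volume.restrict A with hμ
  have hFI : Integrable (fun z : (Fin 3 → ℝ) × (Fin 3 → ℝ) => g z.1 * g z.2) (μ.prod μ) :=
    hgI.mul_prod hgI
  have e1 : TT μ phi g x ^ 2 = TT (μ.prod μ) Phi (fun z => g z.1 * g z.2) x := by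
    unfold TT
    rw [sq, ← integral_prod_mul]
    congr with z
    simp only [Phi, inner_add_left, ee_add]
    ring
  have hae : ∀ᵐ z ∂(μ.prod μ), z ∈ ⋃ i : ℕ × ℕ,
      SS ((1 / 2 : ℝ) ^ i.1 * d) ((1 / 2 : ℝ) ^ i.2 * 1) := by
    have hz : ∀ᵐ z ∂(μ.prod μ), z ∈ A ×ˢ A := by
      rw [hμ, Measure.prod_restrict]
      exact ae_restrict_mem (hA.prod hA)
    filter_upwards [hz, diag_null A 0, diag_null A 2] with z hz h0 h2
    have a0 := hAd _ hz.1
    have b0 := hAd _ hz.2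
    have a2 : z.1 ∈ Set.Icc (fun _ => (0:ℝ)) (fun _ => 1) := hA3 hz.1
    have b2 : z.2 ∈ Set.Icc (fun _ => (0:ℝ)) (fun _ => 1) := hA3 hz.2
    obtain ⟨j, hj⟩ := dyadic d |z.1 0 - z.2 0| hd (abs_pos.2 (sub_ne_zero.2 h0))
      (abs_le.2 ⟨by linarith [a0.1, b0.2], by linarith [a0.2, b0.1]⟩)
    obtain ⟨k, hk⟩ := dyadic 1 |z.1 2 - z.2 2| one_pos (abs_pos.2 (sub_ne_zero.2 h2))
      (abs_le.2 ⟨by have := a2.1 2; have := b2.2 2; simp at *; linarith,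
        by have := a2.2 2; have := b2.1 2; simp at *; linarith⟩)
    exact Set.mem_iUnion.2 ⟨(j, k), hj, hk⟩
  have h := hasSum_integral_iUnion (μ := μ.prod μ) (ι := ℕ × ℕ)
    (f := fun w => g w.1 * g w.2 * ee ⟪Phi w, x⟫_ℝ)
    (s := fun i => SS ((1 / 2 : ℝ) ^ i.1 * d) ((1 / 2 : ℝ) ^ i.2 * 1))
    (fun i => meas_SS _ _) (by
      intro i j hij
      refine Set.disjoint_left.2 fun z hi hj => hij ?_
      exact Prod.ext (dyadic_disj d _ hd _ _ hi.1 hj.1) (dyadic_disj 1 _ one_pos _ _ hi.2 hj.2))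
    (TT_int _ _ _ meas_Phi hFI x).integrableOn
  rw [Measure.restrict_eq_self_of_ae_mem hae] at h
  rw [e1]
  exact h

lemma vol_A (A : Set (Fin 3 → ℝ)) (hA3 : A ⊆ cube3) : volume A ≤ 1 := by
  refine (measure_mono hA3).trans ?_
  unfold cube3
  rw [Real.volume_Icc_pi]
  simp

lemma pow_le (A : Set (Fin 3 → ℝ)) (hA3 : A ⊆ cube3) (g : (Fin 3 → ℝ) → ℂ)
    (hg : Measurable g) (p : ℝ≥0∞) (n : ℕ) (hn : n ≠ 0) (hp : (n : ℝ≥0∞) ≤ p) :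
    ∫⁻ ξ in A, ‖g ξ‖ₑ ^ n ≤ eLpNorm g p (volume.restrict A) ^ n := by
  rw [← eLp_nat _ _ _ hn]
  gcongr
  refine (eLpNorm_le_eLpNorm_mul_rpow_measure_univ hp hg.aestronglyMeasurable).trans ?_
  calc _ ≤ eLpNorm g p (volume.restrict A) * 1 := by
        gcongr
        refine ENNReal.rpow_le_one ?_ ?_
        · simpa using vol_A A hA3
        · rw [sub_nonneg]
          rcases eq_or_ne p ⊤ with rfl | h
          · simp
          · have h1 : (n : ℝ) ≤ p.toReal := by
              simpa using (ENNReal.toReal_le_toReal (by simp) h).2 hp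
            have h2 : (0:ℝ) < n := by positivity
            simpa using one_div_le_one_div_of_le h2 h1
    _ = _ := mul_one _

lemma core (p : ℝ) (hp : 4 < p) (A : Set (Fin 3 → ℝ)) (hA : MeasurableSet A) (hA3 : A ⊆ cube3)
    (d a : ℝ) (hd : 0 < d) (hAd : ∀ ξ ∈ A, ξ 0 ∈ Set.Icc a (a + d)) (g : (Fin 3 → ℝ) → ℂ)
    (hg : Measurable g) (hgI : Integrable g (volume.restrict A))
    (B : Set V5) (hB : MeasurableSet B) (hBf : volume B ≠ ⊤) :
    eLpNorm (TT (volume.restrict A) phi g) (ENNReal.ofReal p) (volume.restrict B) ≤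
      ENNReal.ofReal (16 * (1 - (1 / 2 : ℝ) ^ (1 - 4 / p))⁻¹ * d ^ ((1 - 4 / p) / 2)) *
        eLpNorm g (ENNReal.ofReal p) (volume.restrict A) := by
  have hp0 : 0 < p := by linarith
  set θ := 1 - 4 / p with hθd
  have hθ : 0 < θ := by rw [hθd, sub_pos, div_lt_one hp0]; exact hp
  set N := eLpNorm g (ENNReal.ofReal p) (volume.restrict A) with hN
  set ρ := (1 / 2 : ℝ) ^ θ with hρd
  have hρ0 : 0 < ρ := by positivity
  have hρ1 : ρ < 1 := Real.rpow_lt_one (by norm_num) (by norm_num) hθ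
  have h2 : ∫⁻ ξ in A, ‖g ξ‖ₑ ^ 2 ≤ N ^ 2 := pow_le A hA3 g hg _ 2 (by norm_num) (by
    rw [← ENNReal.ofReal_natCast]; exact ENNReal.ofReal_le_ofReal (by push_cast; linarith))
  have h4 : ∫⁻ ξ in A, ‖g ξ‖ₑ ^ 4 ≤ N ^ 4 := pow_le A hA3 g hg _ 4 (by norm_num) (by
    rw [← ENNReal.ofReal_natCast]; exact ENNReal.ofReal_le_ofReal (by push_cast; linarith))
  have hFI : Integrable (fun z : (Fin 3 → ℝ) × (Fin 3 → ℝ) => g z.1 * g z.2)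
    ((volume.restrict A).prod (volume.restrict A)) := hgI.mul_prod hgI
  have hs := eLp_hasSum (volume.restrict B) (ENNReal.ofReal (p / 2))
    (by rw [← ENNReal.ofReal_one]; exact ENNReal.ofReal_le_ofReal (by linarith))
    (fun i : ℕ × ℕ => TT (((volume.restrict A).prod (volume.restrict A)).restrict
      (SS ((1 / 2 : ℝ) ^ i.1 * d) ((1 / 2 : ℝ) ^ i.2 * 1))) Phi (fun z => g z.1 * g z.2))
    (fun i => (TT_cont _ _ _ meas_Phi hFI.restrict).aestronglyMeasurable)
    (fun x => TT (volume.restrict A) phi g x ^ 2)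
    (fun x => sq_hasSum A hA hA3 d a hd hAd g hgI x)
  have hpc : ∀ i : ℕ × ℕ, eLpNorm (TT (((volume.restrict A).prod (volume.restrict A)).restrict
      (SS ((1 / 2 : ℝ) ^ i.1 * d) ((1 / 2 : ℝ) ^ i.2 * 1))) Phi (fun z => g z.1 * g z.2))
      (ENNReal.ofReal (p / 2)) (volume.restrict B) ≤
      ENNReal.ofReal (256 * d ^ θ) * N ^ 2 * (ENNReal.ofReal ρ ^ i.1 * ENNReal.ofReal ρ ^ i.2) := by
    intro i
    refine (piece A hA hA3 _ _ (by positivity) (by positivity) g hg hgI (p / 2) (by linarith) N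
      h2 h4 B hB hBf).trans (le_of_eq ?_)
    have e : (1 / 2 : ℝ) ^ i.1 * d * ((1 / 2 : ℝ) ^ i.2 * 1) = d * ((1 / 2 : ℝ) ^ i.1 * (1 / 2 : ℝ) ^ i.2) := by
      ring
    have e' : ∀ n : ℕ, ((1 / 2 : ℝ) ^ n) ^ θ = ρ ^ n := by
      intro n
      rw [hρd, ← Real.rpow_natCast, ← Real.rpow_natCast, ← Real.rpow_mul (by norm_num),
        ← Real.rpow_mul (by norm_num), mul_comm]
    rw [show 1 - 2 / (p / 2) = θ by rw [hθd]; field_simp; norm_num, e,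
      Real.mul_rpow hd.le (by positivity), Real.mul_rpow (by positivity) (by positivity), e', e',
      ← mul_assoc, ENNReal.ofReal_mul (p := 256 * d ^ θ) (by positivity),
      ENNReal.ofReal_mul (p := ρ ^ i.1) (by positivity),
      ENNReal.ofReal_pow hρ0.le, ENNReal.ofReal_pow hρ0.le]
    ring
  have hgeo : (1 - ENNReal.ofReal ρ)⁻¹ = ENNReal.ofReal (1 - ρ)⁻¹ := by
    rw [ENNReal.ofReal_inv_of_pos (by linarith), ENNReal.ofReal_sub _ hρ0.le, ENNReal.ofReal_one]
  have hsq := hs.trans (ENNReal.tsum_le_tsum hpc)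
  rw [ENNReal.tsum_mul_left, ENNReal.tsum_prod (f := fun m n => ENNReal.ofReal ρ ^ m * ENNReal.ofReal ρ ^ n)] at hsq
  simp_rw [ENNReal.tsum_mul_left, ENNReal.tsum_mul_right, ENNReal.tsum_geometric, hgeo] at hsq
  have e3 : eLpNorm (fun x => TT (volume.restrict A) phi g x ^ 2) (ENNReal.ofReal (p / 2))
      (volume.restrict B) =
      eLpNorm (TT (volume.restrict A) phi g) (ENNReal.ofReal p) (volume.restrict B) ^ 2 := by
    rw [eLpNorm_eq_lintegral_rpow_enorm_toReal (by simpa using hp0) (by simp),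
      eLpNorm_eq_lintegral_rpow_enorm_toReal (by simpa using hp0) (by simp),
      ENNReal.toReal_ofReal (by positivity), ENNReal.toReal_ofReal hp0.le,
      ← ENNReal.rpow_natCast, ← ENNReal.rpow_mul]
    congr 1
    · refine lintegral_congr fun x => ?_
      rw [enorm_pow, ← ENNReal.rpow_natCast, ← ENNReal.rpow_mul]
      congr 1
      push_cast
      ring
    · push_cast
      field_simp
  rw [e3] at hsq
  rw [← ENNReal.pow_le_pow_left_iff (n := 2) (by norm_num)]
  refine hsq.trans (le_of_eq ?_)
  rw [mul_pow, ← ENNReal.ofReal_pow (by have : 0 < 1 - ρ := by linarith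
                                        positivity), mul_pow, mul_pow]
  have : (d ^ (θ / 2)) ^ 2 = d ^ θ := by
    rw [← Real.rpow_natCast, ← Real.rpow_mul hd.le]
    congr 1
    push_cast
    ring
  rw [this]
  have h1ρ : 0 ≤ (1 - ρ)⁻¹ := inv_nonneg.2 (by linarith)
  rw [show (16 : ℝ) ^ 2 * ((1 - ρ)⁻¹) ^ 2 * d ^ θ = 256 * d ^ θ * ((1 - ρ)⁻¹ * (1 - ρ)⁻¹) by ring,
    ENNReal.ofReal_mul (p := 256 * d ^ θ) (by positivity), ENNReal.ofReal_mul h1ρ]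
  ring

theorem strip_estimate_D2 (p : ℝ) (hp : 4 < p) :
    ∃ ε : ℝ, 0 < ε ∧ ∃ K : ℝ, 1 ≤ K ∧ ∃ C : ℝ, 0 < C ∧
      ∀ M R' : ℝ, K ≤ M → M ≤ R' ^ ((1:ℝ)/2) → K ^ 2 ≤ R' →
        ∀ a : ℝ, Set.Icc a (a + 1/M) ⊆ Set.Icc (0:ℝ) 1 →
        ∀ c : EuclideanSpace ℝ (Fin 5), ∀ f : (Fin 3 → ℝ) → ℂ,
          eLpNorm (eD (Set.indicator
              ({ξ : Fin 3 → ℝ | ξ 0 ∈ Set.Icc a (a + 1/M)} ∩ cube3) f))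
            (ENNReal.ofReal p) (volume.restrict (Metric.ball c R')) ≤
          ENNReal.ofReal (C * M ^ (-ε)) *
            eLpNorm f (ENNReal.ofReal p) (volume.restrict cube3) := by
  have hp0 : 0 < p := by linarith
  have hθ : 0 < 1 - 4 / p := by rw [sub_pos, div_lt_one hp0]; exact hp
  have hρ1 : (1 / 2 : ℝ) ^ (1 - 4 / p) < 1 := Real.rpow_lt_one (by norm_num) (by norm_num) hθ
  have hl : 0 < (1 - (1 / 2 : ℝ) ^ (1 - 4 / p))⁻¹ := inv_pos.2 (by linarith)
  refine ⟨(1 - 4 / p) / 2, by positivity, 1, le_rfl,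
    16 * (1 - (1 / 2 : ℝ) ^ (1 - 4 / p))⁻¹, by positivity, ?_⟩
  intro M R' hM _ _ a _ c f
  have hM0 : 0 < M := by linarith
  set A := {ξ : Fin 3 → ℝ | ξ 0 ∈ Set.Icc a (a + 1 / M)} ∩ cube3 with hAd
  have hc3 : MeasurableSet cube3 := measurableSet_Icc
  have hA : MeasurableSet A := ((measurable_pi_apply 0) measurableSet_Icc).inter hc3
  have hA3 : A ⊆ cube3 := Set.inter_subset_right
  have heD : ∀ x, eD (A.indicator f) x = TT (volume.restrict A) phi f x := by
    intro x
    unfold eD TT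
    have : ∀ ξ : Fin 3 → ℝ, A.indicator f ξ * Complex.exp (2 * (Real.pi : ℂ) * Complex.I *
        ((ξ 0 * x 0 + ξ 1 * x 1 + ξ 2 * x 2 + (ξ 0 * ξ 1 + ξ 2 ^ 2) * x 3
          + ξ 0 ^ 2 * x 4 : ℝ) : ℂ)) =
        A.indicator (fun ξ => f ξ * ee ⟪phi ξ, x⟫_ℝ) ξ := by
      intro ξ
      by_cases h : ξ ∈ A
      · rw [Set.indicator_of_mem h, Set.indicator_of_mem h]
        unfold ee
        congr 4
        simp [PiLp.inner_apply, Fin.sum_univ_five, phi]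
        ring
      · rw [Set.indicator_of_notMem h, Set.indicator_of_notMem h, zero_mul]
    simp_rw [this]
    rw [setIntegral_indicator hA, Set.inter_eq_self_of_subset_right hA3]
  have heD' : eD (A.indicator f) = TT (volume.restrict A) phi f := funext heD
  rw [heD']
  by_cases hfI : Integrable f (volume.restrict A)
  · set g := hfI.1.aemeasurable.mk f with hgd
    have hg : Measurable g := hfI.1.aemeasurable.measurable_mk
    have hfg : f =ᵐ[volume.restrict A] g := hfI.1.aemeasurable.ae_eq_mk
    have e1 : TT (volume.restrict A) phi f = TT (volume.restrict A) phi g := by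
      ext x
      unfold TT
      refine integral_congr_ae ?_
      filter_upwards [hfg] with ξ h
      rw [h]
    rw [e1]
    refine (core p hp A hA hA3 (1 / M) a (by positivity) (fun ξ h => h.1) g hg (hfI.congr hfg)
      (Metric.ball c R') measurableSet_ball measure_ball_lt_top.ne).trans ?_
    rw [← eLpNorm_congr_ae hfg, one_div M, Real.inv_rpow hM0.le, ← Real.rpow_neg hM0.le]
    gcongr
  · have e0 : TT (volume.restrict A) phi f = 0 := by
      ext x
      unfold TT
      refine integral_undef fun h => hfI ?_
      have h' := TT_int (volume.restrict A) phi _ meas_phi h (-x)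
      refine h'.congr (Filter.Eventually.of_forall fun ξ => ?_)
      simp only [mul_assoc, ← ee_add, inner_neg_right, add_neg_cancel]
      simp [ee]
    rw [e0]
    simp
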